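/- arXiv:1402.2365 — 2 statements merged into one kernel-verified Lean document; each statement's English description precedes it below -/
import Mathlib

section
/- Assume additionally that f is convex and argmin_Θ F is nonempty. Let γ ∈ (0, 1/L] and let (θ_n)_{n≥0} be the proximal gradient sequence θ_{n+1} = T_γ(θ_n) started from θ_0 ∈ Dom(g). Then there exists θ⋆ ∈ 𝓛 such that lim_n θ_n = θ⋆. -/
open Filter MeasureTheory Finset
open scoped InnerProductSpace Topology

noncomputable section

variable {E : Type*} [NormedAddCommGroup E] [InnerProductSpace ℝ E]

/-- Convexity of an `EReal`-valued function `g` (codomain `(-∞, +∞]`). -/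
def ERealConvexOn (g : E → EReal) : Prop :=
  ∀ x y : E, ∀ a b : ℝ, 0 ≤ a → 0 ≤ b → a + b = 1 →
    g (a • x + b • y) ≤ (a : EReal) * g x + (b : EReal) * g y

/-- `p` minimizes `v ↦ g v + ‖v - θ‖² / (2γ)`. -/
def IsProxPt (g : E → EReal) (γ : ℝ) (θ p : E) : Prop :=
  ∀ v : E, g p + ((‖p - θ‖ ^ 2 / (2 * γ) : ℝ) : EReal)
      ≤ g v + ((‖v - θ‖ ^ 2 / (2 * γ) : ℝ) : EReal)

/-- Subdifferential of an `EReal`-valued convex function at `θ`. -/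
def subdiff (g : E → EReal) (θ : E) : Set E :=
  {u : E | ∀ v : E, g θ + ((⟪u, v - θ⟫_ℝ : ℝ) : EReal) ≤ g v}

/-- The set `𝓛 = {θ ∈ Dom g : 0 ∈ ∇f(θ) + ∂g(θ)}`. -/
def statPoints (f' : E → E) (g : E → EReal) : Set E :=
  {θ : E | g θ ≠ ⊤ ∧ -f' θ ∈ subdiff g θ}

/-- `F = f + g`, with values in `(-∞, +∞]`. -/
def Fval (f : E → ℝ) (g : E → EReal) (θ : E) : EReal := (f θ : EReal) + g θ

/-- The real value of `F = f + g` (used at points of the domain of `g`). -/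
def Freal (f : E → ℝ) (g : E → EReal) (θ : E) : ℝ := f θ + (g θ).toReal

/-- The proximal gradient map `T_γ(θ) = Prox_γ(θ - γ ∇f(θ))`. -/
def Tmap (prox : ℝ → E → E) (f' : E → E) (γ : ℝ) (θ : E) : E :=
  prox γ (θ - γ • f' θ)

variable [CompleteSpace E]

/-- Standing assumptions: `g` is convex, lower semicontinuous, proper, with values in
`(-∞, +∞]`; `f` is differentiable with `L`-Lipschitz gradient `f'`; and `prox γ θ`
is the unique minimizer of `v ↦ g v + ‖v - θ‖²/(2γ)` for every `γ > 0`. -/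
structure ProxSetting (f : E → ℝ) (f' : E → E) (g : E → EReal) (L : ℝ)
    (prox : ℝ → E → E) : Prop where
  g_ne_bot : ∀ x, g x ≠ ⊥
  g_ne_top : ∃ x, g x ≠ ⊤
  g_lsc : LowerSemicontinuous g
  g_conv : ERealConvexOn g
  f_grad : ∀ x, HasGradientAt f (f' x) x
  L_pos : 0 < L
  lip : ∀ x y, ‖f' x - f' y‖ ≤ L * ‖x - y‖
  prox_spec : ∀ γ : ℝ, 0 < γ → ∀ θ, IsProxPt g γ θ (prox γ θ)
  prox_unique : ∀ γ : ℝ, 0 < γ → ∀ θ p, IsProxPt g γ θ p → p = prox γ θ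

end

theorem aux_lim (A B C : ℝ) (h : ∀ t : ℝ, 0 < t → t ≤ 1 → A ≤ B + t * C) : A ≤ B := by
  have h1 : Tendsto (fun t : ℝ => B + t * C) (𝓝[>] 0) (𝓝 (B + 0 * C)) := by
    apply Tendsto.mono_left _ nhdsWithin_le_nhds
    exact (Continuous.tendsto (by fun_prop) 0)
  have h2 : ∀ᶠ t : ℝ in 𝓝[>] 0, A ≤ B + t * C := by
    have := Ioc_mem_nhdsGT (show (0:ℝ) < 1 by norm_num)
    filter_upwards [this] with t ht
    exact h t ht.1 ht.2
  have := ge_of_tendsto h1 h2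
  simpa using this

theorem aux_descent {E : Type*} [NormedAddCommGroup E] [InnerProductSpace ℝ E]
    [CompleteSpace E] (f : E → ℝ) (f' : E → E) (L : ℝ)
    (hf : ∀ x, HasGradientAt f (f' x) x)
    (lip : ∀ x y, ‖f' x - f' y‖ ≤ L * ‖x - y‖) (x d : E) (t : ℝ) (ht : 0 ≤ t) :
    f (x + t • d) ≤ f x + t * ⟪f' x, d⟫_ℝ + L / 2 * t ^ 2 * ‖d‖ ^ 2 := by
  have hd : ∀ s : ℝ, HasDerivAt
      (fun s : ℝ => f (x + s • d) - s * ⟪f' x, d⟫_ℝ - L / 2 * s ^ 2 * ‖d‖ ^ 2)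
      (⟪f' (x + s • d), d⟫_ℝ - ⟪f' x, d⟫_ℝ - L * s * ‖d‖ ^ 2) s := by
    intro s
    have h1 : HasDerivAt (fun s : ℝ => x + s • d) d s := by
      simpa using ((hasDerivAt_id s).smul_const d).const_add x
    have h2 := (hf (x + s • d)).hasFDerivAt.comp_hasDerivAt s h1
    have h3 : HasDerivAt (fun s : ℝ => s * ⟪f' x, d⟫_ℝ) (⟪f' x, d⟫_ℝ) s := by
      simpa using (hasDerivAt_id s).mul_const (⟪f' x, d⟫_ℝ)
    have h4 : HasDerivAt (fun s : ℝ => L / 2 * s ^ 2 * ‖d‖ ^ 2) (L * s * ‖d‖ ^ 2) s := by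
      have := (((hasDerivAt_id s).pow 2).const_mul (L / 2)).mul_const (‖d‖ ^ 2)
      refine this.congr_deriv ?_
      simp only [id_eq, Nat.cast_ofNat]
      norm_num
      try ring_nf
      try simp
    have h5 := (h2.sub h3).sub h4
    refine h5.congr_deriv ?_
    simp
  have hanti : AntitoneOn
      (fun s : ℝ => f (x + s • d) - s * ⟪f' x, d⟫_ℝ - L / 2 * s ^ 2 * ‖d‖ ^ 2) (Set.Ici 0) := by
    apply antitoneOn_of_deriv_nonpos (convex_Ici 0)
    · exact fun s _ => (hd s).continuousAt.continuousWithinAt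
    · exact fun s _ => (hd s).differentiableAt.differentiableWithinAt
    · intro s hs
      rw [(hd s).deriv]
      rw [interior_Ici] at hs
      have hs' : 0 < s := hs
      have h1 : ⟪f' (x + s • d) - f' x, d⟫_ℝ ≤ ‖f' (x + s • d) - f' x‖ * ‖d‖ :=
        real_inner_le_norm _ _
      have h2 := lip (x + s • d) x
      rw [add_sub_cancel_left, norm_smul, Real.norm_of_nonneg hs'.le] at h2
      rw [inner_sub_left] at h1
      have h3 := mul_le_mul_of_nonneg_right h2 (norm_nonneg d)
      nlinarith
  have := hanti (Set.mem_Ici.2 le_rfl) (Set.mem_Ici.2 ht) ht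
  simp at this
  linarith

theorem aux_grad {E : Type*} [NormedAddCommGroup E] [InnerProductSpace ℝ E]
    [CompleteSpace E] (f : E → ℝ) (f' : E → E) (L : ℝ)
    (hf : ∀ x, HasGradientAt f (f' x) x)
    (lip : ∀ x y, ‖f' x - f' y‖ ≤ L * ‖x - y‖) (hc : ConvexOn ℝ Set.univ f) (x v : E) :
    f x + ⟪f' x, v - x⟫_ℝ ≤ f v := by
  suffices h : f x + ⟪f' x, v - x⟫_ℝ - f v ≤ 0 by linarith
  apply aux_lim _ _ (L / 2 * ‖v - x‖ ^ 2)
  intro t h0 h1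
  have a := aux_descent (fun x => - f x) (fun x => - f' x) L
    (fun x => by
      have := (hf x).hasFDerivAt.neg
      rw [hasGradientAt_iff_hasFDerivAt]
      rw [map_neg]
      exact this)
    (fun x y => by
      have := lip x y
      have e : - f' x - - f' y = -(f' x - f' y) := by abel
      show ‖- f' x - - f' y‖ ≤ _
      rw [e, norm_neg]
      exact this) x (v - x) t h0.le
  have b := hc.2 (Set.mem_univ x) (Set.mem_univ v) (sub_nonneg.2 h1) h0.le (by ring)
  have e : (1 - t) • x + t • v = x + t • (v - x) := by module
  rw [e] at b
  simp only [inner_neg_left, smul_eq_mul] at a b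
  have : t * (f x + ⟪f' x, v - x⟫_ℝ - f v) ≤ t * (0 + t * (L / 2 * ‖v - x‖ ^ 2)) := by
    nlinarith
  exact le_of_mul_le_mul_left this h0

theorem aux_conv {E : Type*} [NormedAddCommGroup E] [InnerProductSpace ℝ E]
    (g : E → EReal) (hb : ∀ x, g x ≠ ⊥) (hc : ERealConvexOn g) (x v : E)
    (hx : g x ≠ ⊤) (hv : g v ≠ ⊤) (t : ℝ) (h0 : 0 ≤ t) (h1 : t ≤ 1) :
    g (x + t • (v - x)) ≠ ⊤ ∧
    (g (x + t • (v - x))).toReal ≤ (1 - t) * (g x).toReal + t * (g v).toReal := by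
  have b := hc x v (1 - t) t (sub_nonneg.2 h1) h0 (by ring)
  have e : (1 - t) • x + t • v = x + t • (v - x) := by module
  rw [e, ← EReal.coe_toReal hx (hb x), ← EReal.coe_toReal hv (hb v), ← EReal.coe_mul,
    ← EReal.coe_mul, ← EReal.coe_add] at b
  have hne : g (x + t • (v - x)) ≠ ⊤ := ne_top_of_le_ne_top (EReal.coe_ne_top _) b
  refine ⟨hne, ?_⟩
  rw [← EReal.coe_toReal hne (hb _)] at b
  exact_mod_cast b

theorem aux_prox {E : Type*} [NormedAddCommGroup E] [InnerProductSpace ℝ E]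
    (g : E → EReal) (hb : ∀ x, g x ≠ ⊥) (hc : ERealConvexOn g) (γ : ℝ) (hγ : 0 < γ) (y p v : E)
    (hp : IsProxPt g γ y p) (hv : g v ≠ ⊤) :
    g p ≠ ⊤ ∧ γ * ((g p).toReal - (g v).toReal) ≤ ⟪p - y, v - p⟫_ℝ := by
  have key : ∀ w, g w ≠ ⊤ → g p ≠ ⊤ ∧ (g p).toReal + ‖p - y‖ ^ 2 / (2 * γ) ≤
      (g w).toReal + ‖w - y‖ ^ 2 / (2 * γ) := by
    intro w hw
    have b := hp w
    rw [← EReal.coe_toReal hw (hb w), ← EReal.coe_add] at b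
    have hne : g p ≠ ⊤ := by
      intro h
      rw [h, EReal.top_add_coe] at b
      exact EReal.coe_ne_top _ (top_le_iff.1 b)
    refine ⟨hne, ?_⟩
    rw [← EReal.coe_toReal hne (hb _)] at b
    exact_mod_cast b
  have hpt := (key v hv).1
  refine ⟨hpt, ?_⟩
  apply aux_lim _ _ (‖v - p‖ ^ 2 / 2)
  intro t h0 h1
  obtain ⟨c1, c2⟩ := aux_conv g hb hc p v hpt hv t h0.le h1
  have k := (key _ c1).2
  have e : ‖p + t • (v - p) - y‖ ^ 2 =
      ‖p - y‖ ^ 2 + 2 * (t * ⟪p - y, v - p⟫_ℝ) + t ^ 2 * ‖v - p‖ ^ 2 := by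
    rw [show p + t • (v - p) - y = (p - y) + t • (v - p) by abel, norm_add_sq_real,
      inner_smul_right, norm_smul, mul_pow, Real.norm_eq_abs, sq_abs]
  rw [e] at k
  have k2 := mul_le_mul_of_nonneg_left k (show 0 ≤ 2 * γ by positivity)
  rw [mul_add, mul_add, mul_div_cancel₀ _ (by positivity), mul_div_cancel₀ _ (by positivity)] at k2
  have c3 := mul_le_mul_of_nonneg_left c2 (show 0 ≤ 2 * γ by positivity)
  have : t * (γ * ((g p).toReal - (g v).toReal)) ≤
      t * (⟪p - y, v - p⟫_ℝ + t * (‖v - p‖ ^ 2 / 2)) := by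
    nlinarith
  exact le_of_mul_le_mul_left this h0

theorem aux_step {E : Type*} [NormedAddCommGroup E] [InnerProductSpace ℝ E] [CompleteSpace E]
    (f : E → ℝ) (f' : E → E) (g : E → EReal) (L : ℝ) (prox : ℝ → E → E)
    (hs : ProxSetting f f' g L prox)
    (hfconv : ConvexOn ℝ Set.univ f)
    (γ : ℝ) (hγ0 : 0 < γ) (hγL : γ ≤ 1 / L) (x v : E) (hv : g v ≠ ⊤) :
    g (Tmap prox f' γ x) ≠ ⊤ ∧
    2 * γ * (Freal f g (Tmap prox f' γ x) - Freal f g v) ≤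
      ‖x - v‖ ^ 2 - ‖Tmap prox f' γ x - v‖ ^ 2 := by
  obtain ⟨h1, h2⟩ := aux_prox g hs.g_ne_bot hs.g_conv γ hγ0 (x - γ • f' x) (Tmap prox f' γ x) v
    (hs.prox_spec γ hγ0 _) hv
  refine ⟨h1, ?_⟩
  generalize Tmap prox f' γ x = p at *
  have h3 := aux_descent f f' L hs.f_grad hs.lip x (p - x) 1 zero_le_one
  have h4 := aux_grad f f' L hs.f_grad hs.lip hfconv x v
  rw [one_smul, add_sub_cancel] at h3
  have hL := hs.L_pos
  have h5 : γ * L ≤ 1 := by rwa [le_div_iff₀ hL] at hγL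
  have e1 : ⟪p - (x - γ • f' x), v - p⟫_ℝ =
      ⟪p - x, v - p⟫_ℝ + γ * (⟪f' x, v - x⟫_ℝ - ⟪f' x, p - x⟫_ℝ) := by
    rw [show p - (x - γ • f' x) = (p - x) + γ • f' x by abel, inner_add_left,
      real_inner_smul_left, ← inner_sub_right, sub_sub_sub_cancel_right]
  have e2 : ‖x - v‖ ^ 2 = ‖p - x‖ ^ 2 + 2 * ⟪p - x, v - p⟫_ℝ + ‖p - v‖ ^ 2 := by
    rw [← norm_neg (x - v), ← norm_neg (p - v), neg_sub, neg_sub,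
      show v - x = (p - x) + (v - p) by abel, norm_add_sq_real]
  unfold Freal
  have h6 := mul_le_mul_of_nonneg_left h3 hγ0.le
  have h7 := mul_le_mul_of_nonneg_left h4 hγ0.le
  have h8 := mul_le_mul_of_nonneg_right h5 (sq_nonneg ‖p - x‖)
  nlinarith

theorem aux_min {E : Type*} [NormedAddCommGroup E] [InnerProductSpace ℝ E] [CompleteSpace E]
    (f : E → ℝ) (f' : E → E) (g : E → EReal) (L : ℝ) (prox : ℝ → E → E)
    (hs : ProxSetting f f' g L prox) (s : E) (hst : g s ≠ ⊤)
    (hmin : ∀ v, g v ≠ ⊤ → Freal f g s ≤ Freal f g v) : s ∈ statPoints f' g := by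
  refine ⟨hst, ?_⟩
  intro v
  by_cases hv : g v = ⊤
  · rw [hv]; exact le_top
  rw [← EReal.coe_toReal hst (hs.g_ne_bot s), ← EReal.coe_toReal hv (hs.g_ne_bot v),
    ← EReal.coe_add, EReal.coe_le_coe_iff, inner_neg_left]
  suffices h : (g s).toReal - (g v).toReal ≤ ⟪f' s, v - s⟫_ℝ by linarith
  apply aux_lim _ _ (L / 2 * ‖v - s‖ ^ 2)
  intro t h0 h1
  have a := aux_descent f f' L hs.f_grad hs.lip s (v - s) t h0.le
  obtain ⟨c1, c2⟩ := aux_conv g hs.g_ne_bot hs.g_conv s v hst hv t h0.le h1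
  have m := hmin _ c1
  unfold Freal at m
  have : t * ((g s).toReal - (g v).toReal) ≤
      t * (⟪f' s, v - s⟫_ℝ + t * (L / 2 * ‖v - s‖ ^ 2)) := by nlinarith
  exact le_of_mul_le_mul_left this h0

/-- **Corollary** (convergence of the exact proximal gradient algorithm, convex case). -/
theorem stmt1
    {E : Type*} [NormedAddCommGroup E] [InnerProductSpace ℝ E] [FiniteDimensional ℝ E]
    (f : E → ℝ) (f' : E → E) (g : E → EReal) (L : ℝ) (prox : ℝ → E → E)
    (hs : ProxSetting f f' g L prox)
    (hfconv : ConvexOn ℝ Set.univ f)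
    (hargmin : ∃ m : E, ∀ v : E, Fval f g m ≤ Fval f g v)
    (γ : ℝ) (hγ0 : 0 < γ) (hγL : γ ≤ 1 / L)
    (θ : ℕ → E) (hθ0 : g (θ 0) ≠ ⊤)
    (hrec : ∀ n : ℕ, θ (n + 1) = Tmap prox f' γ (θ n)) :
    ∃ θs ∈ statPoints f' g, Tendsto θ atTop (nhds θs) := by
  obtain ⟨m, hm⟩ := hargmin
  have hb := hs.g_ne_bot
  have hmt : g m ≠ ⊤ := by
    intro h
    have := hm (θ 0)
    unfold Fval at this
    rw [h, EReal.coe_add_top, ← EReal.coe_toReal hθ0 (hb _), ← EReal.coe_add] at this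
    exact EReal.coe_ne_top _ (top_le_iff.1 this)
  have hmin : ∀ v, g v ≠ ⊤ → Freal f g m ≤ Freal f g v := by
    intro v hv
    have := hm v
    unfold Fval at this
    rw [← EReal.coe_toReal hmt (hb _), ← EReal.coe_toReal hv (hb _)] at this
    unfold Freal
    exact_mod_cast this
  have hstep : ∀ v, g v ≠ ⊤ → ∀ n, g (θ (n + 1)) ≠ ⊤ ∧
      2 * γ * (Freal f g (θ (n + 1)) - Freal f g v) ≤ ‖θ n - v‖ ^ 2 - ‖θ (n + 1) - v‖ ^ 2 := by
    intro v hv n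
    rw [hrec n]
    exact aux_step f f' g L prox hs hfconv γ hγ0 hγL (θ n) v hv
  have hdom : ∀ n, g (θ n) ≠ ⊤ := by
    intro n
    cases n with
    | zero => exact hθ0
    | succ n => exact (hstep m hmt n).1
  have hanti : ∀ v, g v ≠ ⊤ → Freal f g v ≤ Freal f g m →
      Antitone (fun n => ‖θ n - v‖ ^ 2) := by
    intro v hv hvm
    apply antitone_nat_of_succ_le
    intro n
    have h1 := (hstep v hv n).2
    have h2 := hmin _ (hdom (n + 1))
    have : 0 ≤ 2 * γ * (Freal f g (θ (n + 1)) - Freal f g v) :=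
      mul_nonneg (by positivity) (by linarith)
    linarith
  have hconv : ∀ v, g v ≠ ⊤ → Freal f g v ≤ Freal f g m →
      ∃ l, Tendsto (fun n => ‖θ n - v‖ ^ 2) atTop (𝓝 l) := by
    intro v hv hvm
    exact ⟨_, tendsto_atTop_ciInf (hanti v hv hvm) ⟨0, by
      rintro _ ⟨n, rfl⟩
      positivity⟩⟩
  have hF1 : Tendsto (fun n => Freal f g (θ (n + 1))) atTop (𝓝 (Freal f g m)) := by
    obtain ⟨l, hl⟩ := hconv m hmt le_rfl
    have hl' := (tendsto_add_atTop_iff_nat 1).2 hl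
    have h1 := (((hl.sub hl').div_const (2 * γ)).const_add (Freal f g m))
    rw [sub_self, zero_div, add_zero] at h1
    refine tendsto_of_tendsto_of_tendsto_of_le_of_le tendsto_const_nhds h1
      (fun n => hmin _ (hdom (n + 1))) (fun n => ?_)
    have h2 := (hstep m hmt n).2
    have h3 : Freal f g (θ (n + 1)) - Freal f g m ≤
        (‖θ n - m‖ ^ 2 - ‖θ (n + 1) - m‖ ^ 2) / (2 * γ) := by
      rw [le_div_iff₀ (by positivity)]
      linarith
    show Freal f g (θ (n + 1)) ≤
      Freal f g m + (‖θ n - m‖ ^ 2 - ‖θ (n + 1) - m‖ ^ 2) / (2 * γ)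
    linarith
  have hF : Tendsto (fun n => Freal f g (θ n)) atTop (𝓝 (Freal f g m)) :=
    (tendsto_add_atTop_iff_nat 1).1 hF1
  have hball : ∀ n, θ n ∈ Metric.closedBall m ‖θ 0 - m‖ := by
    intro n
    rw [mem_closedBall_iff_norm]
    exact le_of_sq_le_sq (hanti m hmt le_rfl (Nat.zero_le n)) (norm_nonneg _)
  have : ProperSpace E := FiniteDimensional.proper ℝ E
  obtain ⟨s, -, φ, hφ, hlim⟩ := (isCompact_closedBall m ‖θ 0 - m‖).tendsto_subseq hball
  have hfc : Continuous f := by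
    rw [continuous_iff_continuousAt]
    exact fun x => (hs.f_grad x).continuousAt
  have hgle : g s ≤ ((Freal f g m - f s : ℝ) : EReal) := by
    by_contra hcon
    rw [not_le] at hcon
    obtain ⟨c, hc1, hc2⟩ := EReal.lt_iff_exists_real_btwn.1 hcon
    rw [EReal.coe_lt_coe_iff] at hc1
    have e1 := hlim.eventually (hs.g_lsc s c hc2)
    have e2 := ((hF.comp hφ.tendsto_atTop).sub ((hfc.tendsto s).comp hlim)).eventually
      (gt_mem_nhds hc1)
    obtain ⟨n, h1, h2⟩ := (e1.and e2).exists
    have h3 : (c : EReal) < g (θ (φ n)) := h1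
    rw [← EReal.coe_toReal (hdom _) (hb _), EReal.coe_lt_coe_iff] at h3
    have h4 : f (θ (φ n)) + (g (θ (φ n))).toReal - f (θ (φ n)) < c := h2
    linarith
  have hst : g s ≠ ⊤ := ne_top_of_le_ne_top (EReal.coe_ne_top _) hgle
  have hsm : Freal f g s ≤ Freal f g m := by
    rw [← EReal.coe_toReal hst (hb _), EReal.coe_le_coe_iff] at hgle
    have : f s + (g s).toReal ≤ Freal f g m := by linarith
    exact this
  refine ⟨s, aux_min f f' g L prox hs s hst (fun v hv => hsm.trans (hmin v hv)), ?_⟩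
  obtain ⟨l, hl⟩ := hconv s hst hsm
  have h0 : Tendsto (fun n => ‖θ (φ n) - s‖ ^ 2) atTop (𝓝 0) := by
    have := ((tendsto_iff_norm_sub_tendsto_zero.1 hlim).pow 2)
    simpa using this
  have hl0 : l = 0 := tendsto_nhds_unique (hl.comp hφ.tendsto_atTop) h0
  rw [hl0] at hl
  rw [tendsto_iff_norm_sub_tendsto_zero]
  have := hl.sqrt
  simpa [Real.sqrt_sq] using this
end

section
/- Assume additionally that f is convex and argmin_Θ F is nonempty. Let (θ_n)_{n≥0} be the random perturbed proximal gradient sequence with step sizes γ_n ∈ (0, 1/L] for all n ≥ 1. Suppose that almost surely limsup_n ‖θ_n‖ < ∞, and that for every B ≥ 0, Σ_{n≥0} γ_{n+1} (ε_n^{(1)} + γ_{n+1} ε_n^{(2)}) 1_{‖θ_n‖ ≤ B} < ∞ almost surely. Then almost surely, for every θ⋆ ∈ 𝓛 the limit lim_n ‖θ_n − θ⋆‖ exists. If in addition Σ_n γ_n = +∞, then almost surely there exists θ⋆ ∈ 𝓛 such that lim_n θ_n = θ⋆. -/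
open Filter MeasureTheory Finset
open scoped InnerProductSpace Topology

lemma px_limit {a b c : ℝ} (h : ∀ t : ℝ, 0 < t → t ≤ 1 → a ≤ b + t * c) : a ≤ b := by
  by_contra hlt
  push Not at hlt
  have h1 := h (min 1 ((a - b) / (2 * (|c| + 1)))) (by
    have : 0 < (a - b) / (2 * (|c| + 1)) := by
      apply div_pos (by linarith); positivity
    exact lt_min one_pos this) (min_le_left _ _)
  set t := min 1 ((a - b) / (2 * (|c| + 1))) with ht
  have ht0 : 0 ≤ t := by
    apply le_min zero_le_one
    apply div_nonneg (by linarith); positivity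
  have h2 : t * (2 * (|c| + 1)) ≤ a - b := by
    rw [← le_div_iff₀ (by positivity)]; exact min_le_right _ _
  have h3 : t * c ≤ t * |c| := mul_le_mul_of_nonneg_left (le_abs_self c) ht0
  nlinarith

section det
variable {E : Type*} [NormedAddCommGroup E] [InnerProductSpace ℝ E] [CompleteSpace E]

lemma px_descent {f : E → ℝ} {f' : E → E} {L : ℝ} (hf : ∀ x, HasGradientAt f (f' x) x)
    (hl : ∀ x y, ‖f' x - f' y‖ ≤ L * ‖x - y‖) (x d : E) :
    f (x + d) ≤ f x + ⟪f' x, d⟫_ℝ + L / 2 * ‖d‖ ^ 2 := by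
  have hd : ∀ t : ℝ, HasDerivAt (fun t : ℝ => f (x + t • d) - t * ⟪f' x, d⟫_ℝ - L / 2 * ‖d‖ ^ 2 * t ^ 2)
      (⟪f' (x + t • d), d⟫_ℝ - ⟪f' x, d⟫_ℝ - L / 2 * ‖d‖ ^ 2 * (2 * t)) t := by
    intro t
    have h1 : HasDerivAt (fun t : ℝ => x + t • d) d t := by
      simpa using ((hasDerivAt_id t).smul_const d).const_add x
    have h2 := (hf (x + t • d)).hasFDerivAt.comp_hasDerivAt t h1
    have h3 : HasDerivAt (fun t : ℝ => t * ⟪f' x, d⟫_ℝ) (⟪f' x, d⟫_ℝ) t := by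
      simpa using (hasDerivAt_id t).mul_const (⟪f' x, d⟫_ℝ)
    have h4 : HasDerivAt (fun t : ℝ => L / 2 * ‖d‖ ^ 2 * t ^ 2) (L / 2 * ‖d‖ ^ 2 * (2 * t)) t := by
      simpa using (hasDerivAt_pow 2 t).const_mul (L / 2 * ‖d‖ ^ 2)
    have h5 := (h2.sub h3).sub h4
    simp at h5
    exact h5
  have hanti : AntitoneOn (fun t : ℝ => f (x + t • d) - t * ⟪f' x, d⟫_ℝ - L / 2 * ‖d‖ ^ 2 * t ^ 2)
      (Set.Icc 0 1) := by
    apply antitoneOn_of_deriv_nonpos (convex_Icc 0 1)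
    · exact fun t _ => (hd t).continuousAt.continuousWithinAt
    · exact fun t _ => (hd t).differentiableAt.differentiableWithinAt
    · intro t ht
      rw [interior_Icc] at ht
      rw [(hd t).deriv, ← inner_sub_left]
      have h1 := real_inner_le_norm (f' (x + t • d) - f' x) d
      have h2 := hl (x + t • d) x
      have h3 : ‖x + t • d - x‖ = t * ‖d‖ := by
        rw [add_sub_cancel_left, norm_smul, Real.norm_of_nonneg ht.1.le]
      rw [h3] at h2
      have h4 := mul_le_mul_of_nonneg_right h2 (norm_nonneg d)
      nlinarith
  have := hanti (show (0:ℝ) ∈ Set.Icc 0 1 by simp) (show (1:ℝ) ∈ Set.Icc 0 1 by simp) zero_le_one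
  simp at this
  linarith

lemma px_ascent {f : E → ℝ} {f' : E → E} {L : ℝ} (hf : ∀ x, HasGradientAt f (f' x) x)
    (hl : ∀ x y, ‖f' x - f' y‖ ≤ L * ‖x - y‖) (x d : E) :
    f x + ⟪f' x, d⟫_ℝ - L / 2 * ‖d‖ ^ 2 ≤ f (x + d) := by
  have := px_descent (f := fun x => - f x) (f' := fun x => - f' x) (L := L)
    (fun x => by
      have := (hf x).hasFDerivAt.neg
      rw [hasGradientAt_iff_hasFDerivAt]
      simp only [map_neg]
      exact this)
    (fun x y => by
      have := hl x y
      rwa [← norm_neg, show -(-f' x - -f' y) = f' x - f' y by abel]) x d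
  simp only [inner_neg_left] at this
  linarith

lemma px_convex {f : E → ℝ} {f' : E → E} {L : ℝ} (hf : ∀ x, HasGradientAt f (f' x) x)
    (hl : ∀ x y, ‖f' x - f' y‖ ≤ L * ‖x - y‖) (hc : ConvexOn ℝ Set.univ f) (x v : E) :
    f x + ⟪f' x, v - x⟫_ℝ ≤ f v := by
  apply px_limit (c := L / 2 * ‖v - x‖ ^ 2)
  intro t ht ht1
  have h1 := px_ascent hf hl x (t • (v - x))
  have h2 := hc.2 (Set.mem_univ x) (Set.mem_univ v) (show 0 ≤ 1 - t by linarith) ht.le (by ring)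
  have h3 : (1 - t) • x + t • v = x + t • (v - x) := by module
  rw [h3] at h2
  rw [inner_smul_right, norm_smul, Real.norm_of_nonneg ht.le] at h1
  simp only [smul_eq_mul] at h2
  have : t * (f x + ⟪f' x, v - x⟫_ℝ) ≤ t * (f v + t * (L / 2 * ‖v - x‖ ^ 2)) := by nlinarith
  exact le_of_mul_le_mul_left this ht

variable {f : E → ℝ} {f' : E → E} {g : E → EReal} {L : ℝ} {prox : ℝ → E → E}

lemma px_coe (hs : ProxSetting f f' g L prox) {x : E} (hx : g x ≠ ⊤) :
    ((g x).toReal : EReal) = g x := EReal.coe_toReal hx (hs.g_ne_bot x)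

lemma px_gconv (hs : ProxSetting f f' g L prox) {x y : E} (hx : g x ≠ ⊤) (hy : g y ≠ ⊤)
    {t : ℝ} (ht : 0 ≤ t) (ht1 : t ≤ 1) :
    g (x + t • (y - x)) ≠ ⊤ ∧
      (g (x + t • (y - x))).toReal ≤ (1 - t) * (g x).toReal + t * (g y).toReal := by
  have h := hs.g_conv x y (1 - t) t (by linarith) ht (by ring)
  have h3 : (1 - t) • x + t • y = x + t • (y - x) := by module
  rw [h3, ← px_coe hs hx, ← px_coe hs hy, ← EReal.coe_mul, ← EReal.coe_mul, ← EReal.coe_add] at h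
  have hne : g (x + t • (y - x)) ≠ ⊤ := ne_top_of_le_ne_top (EReal.coe_ne_top _) h
  refine ⟨hne, ?_⟩
  rw [← px_coe hs hne] at h
  exact_mod_cast h

lemma px_prox_dom (hs : ProxSetting f f' g L prox) {γ : ℝ} (hγ : 0 < γ) (x : E) :
    g (prox γ x) ≠ ⊤ := by
  obtain ⟨v, hv⟩ := hs.g_ne_top
  have h := hs.prox_spec γ hγ x v
  intro htop
  rw [htop, ← px_coe hs hv, ← EReal.coe_add, EReal.top_add_coe] at h
  exact EReal.coe_ne_top _ (top_le_iff.1 h)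

lemma px_prox_ineq (hs : ProxSetting f f' g L prox) {γ : ℝ} (hγ : 0 < γ) (x : E) {v : E}
    (hv : g v ≠ ⊤) :
    γ * (g (prox γ x)).toReal + ⟪x - prox γ x, v - prox γ x⟫_ℝ ≤ γ * (g v).toReal := by
  have hp := px_prox_dom hs hγ x
  have hm := hs.prox_spec γ hγ x
  set p := prox γ x with hpdef
  apply px_limit (c := ‖v - p‖ ^ 2 / 2)
  intro t ht ht1
  obtain ⟨h1, h2⟩ := px_gconv hs hp hv ht.le ht1
  have h3 := hm (p + t • (v - p))
  rw [← px_coe hs hp, ← px_coe hs h1, ← EReal.coe_add, ← EReal.coe_add, EReal.coe_le_coe_iff] at h3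
  have h4 : ‖p + t • (v - p) - x‖ ^ 2 = ‖p - x‖ ^ 2 - 2 * t * ⟪x - p, v - p⟫_ℝ + t ^ 2 * ‖v - p‖ ^ 2 := by
    rw [show p + t • (v - p) - x = (p - x) + t • (v - p) by abel, norm_add_sq_real,
      inner_smul_right, norm_smul, Real.norm_of_nonneg ht.le, ← neg_sub x p, inner_neg_left]
    ring
  rw [h4] at h3
  have h5 := mul_le_mul_of_nonneg_left h3 hγ.le
  have e : ∀ a b : ℝ, γ * (a + b / (2 * γ)) = γ * a + b / 2 := by
    intro a b; field_simp
  rw [e, e] at h5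
  have h6 := mul_le_mul_of_nonneg_left h2 hγ.le
  refine le_of_mul_le_mul_left (a := t) ?_ ht
  nlinarith

lemma px_nonexp (hs : ProxSetting f f' g L prox) {γ : ℝ} (hγ : 0 < γ) (x y : E) :
    ‖prox γ x - prox γ y‖ ≤ ‖x - y‖ := by
  have h1 := px_prox_ineq hs hγ x (px_prox_dom hs hγ y)
  have h2 := px_prox_ineq hs hγ y (px_prox_dom hs hγ x)
  set p := prox γ x
  set q := prox γ y
  have h3 : ‖p - q‖ ^ 2 ≤ ⟪x - y, p - q⟫_ℝ := by
    have e : ⟪x - p, q - p⟫_ℝ + ⟪y - q, p - q⟫_ℝ = ‖p - q‖ ^ 2 - ⟪x - y, p - q⟫_ℝ := by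
      rw [← real_inner_self_eq_norm_sq, ← neg_sub p q, inner_neg_right, ← sub_eq_neg_add,
        ← inner_sub_left, ← inner_sub_left]
      congr 1; abel
    linarith
  have h4 := real_inner_le_norm (x - y) (p - q)
  by_contra hlt
  push Not at hlt
  nlinarith [norm_nonneg (x - y), norm_nonneg (p - q)]

lemma px_main (hs : ProxSetting f f' g L prox) (hc : ConvexOn ℝ Set.univ f)
    {γ : ℝ} (hγ : 0 < γ) (hγL : γ ≤ 1 / L) (x h : E) {v : E} (hv : g v ≠ ⊤) :
    ‖prox γ (x - γ • h) - v‖ ^ 2 + 2 * γ * (Freal f g (prox γ (x - γ • h)) - Freal f g v)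
      ≤ ‖x - v‖ ^ 2 - 2 * γ * ⟪prox γ (x - γ • h) - v, h - f' x⟫_ℝ := by
  have h1 := px_prox_ineq hs hγ (x - γ • h) hv
  set p := prox γ (x - γ • h)
  have h2 := px_descent hs.f_grad hs.lip x (p - x)
  have h3 := px_convex hs.f_grad hs.lip hc x v
  have hgl : γ * L ≤ 1 := by rwa [le_div_iff₀ hs.L_pos] at hγL
  rw [add_sub_cancel] at h2
  have e1 : ‖x - v‖ ^ 2 = ‖x - p‖ ^ 2 - 2 * ⟪x - p, v - p⟫_ℝ + ‖p - v‖ ^ 2 := by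
    rw [show x - v = (x - p) - (v - p) by abel, norm_sub_sq_real, norm_sub_rev v p]
  have e2 : ⟪x - γ • h - p, v - p⟫_ℝ = ⟪x - p, v - p⟫_ℝ + γ * ⟪p - v, h⟫_ℝ := by
    rw [show x - γ • h - p = (x - p) - γ • h by abel, inner_sub_left, inner_smul_left,
      ← neg_sub p v, inner_neg_right, inner_neg_right, real_inner_comm h]
    simp
  have e3 : ⟪f' x, p - x⟫_ℝ - ⟪f' x, v - x⟫_ℝ = ⟪p - v, f' x⟫_ℝ := by
    rw [← inner_sub_right, real_inner_comm]; congr 1; abel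
  have e4 : ‖p - x‖ = ‖x - p‖ := norm_sub_rev _ _
  rw [e2] at h1
  rw [e1, inner_sub_right (p - v) h]
  unfold Freal
  rw [e4] at h2
  have h5 := mul_le_mul_of_nonneg_right hgl (sq_nonneg ‖x - p‖)
  have h6 := mul_le_mul_of_nonneg_left h2 hγ.le
  have h7 := mul_le_mul_of_nonneg_left h3 hγ.le
  have e5 : γ * (⟪f' x, p - x⟫_ℝ - ⟪f' x, v - x⟫_ℝ) = γ * ⟪p - v, f' x⟫_ℝ := by rw [e3]
  nlinarith

lemma px_stat_of_min (hs : ProxSetting f f' g L prox) {m : E} (hm : g m ≠ ⊤)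
    (hmin : ∀ v, g v ≠ ⊤ → Freal f g m ≤ Freal f g v) : m ∈ statPoints f' g := by
  refine ⟨hm, fun v => ?_⟩
  by_cases hv : g v = ⊤
  · rw [hv]; exact le_top
  rw [← px_coe hs hm, ← px_coe hs hv, ← EReal.coe_add, EReal.coe_le_coe_iff, inner_neg_left]
  apply px_limit (c := L / 2 * ‖v - m‖ ^ 2)
  intro t ht ht1
  obtain ⟨h1, h2⟩ := px_gconv hs hm hv ht.le ht1
  have h3 := hmin _ h1
  have h4 := px_descent hs.f_grad hs.lip m (t • (v - m))
  rw [inner_smul_right, norm_smul, Real.norm_of_nonneg ht.le] at h4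
  unfold Freal at h3
  refine le_of_mul_le_mul_left (a := t) ?_ ht
  nlinarith

lemma px_min_of_stat (hs : ProxSetting f f' g L prox) (hc : ConvexOn ℝ Set.univ f) {m : E}
    (hm : m ∈ statPoints f' g) (v : E) (hv : g v ≠ ⊤) : Freal f g m ≤ Freal f g v := by
  have h := hm.2 v
  rw [← px_coe hs hm.1, ← px_coe hs hv, ← EReal.coe_add, EReal.coe_le_coe_iff, inner_neg_left] at h
  have := px_convex hs.f_grad hs.lip hc m v
  unfold Freal
  linarith

lemma px_exists_stat (hs : ProxSetting f f' g L prox)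
    (hargmin : ∃ m : E, ∀ v : E, Fval f g m ≤ Fval f g v) : ∃ m, m ∈ statPoints f' g := by
  obtain ⟨m, hm⟩ := hargmin
  obtain ⟨w, hw⟩ := hs.g_ne_top
  have hmt : g m ≠ ⊤ := by
    intro htop
    have := hm w
    unfold Fval at this
    rw [htop, ← px_coe hs hw, ← EReal.coe_add, EReal.coe_add_top] at this
    exact EReal.coe_ne_top _ (top_le_iff.1 this)
  refine ⟨m, px_stat_of_min hs hmt fun v hv => ?_⟩
  have := hm v
  unfold Fval at this
  rw [← px_coe hs hmt, ← px_coe hs hv] at this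
  unfold Freal
  exact_mod_cast this

lemma px_stoch (hs : ProxSetting f f' g L prox) (hc : ConvexOn ℝ Set.univ f)
    {γ : ℝ} (hγ : 0 < γ) (hγL : γ ≤ 1 / L) (x h : E) {v : E} (hv : v ∈ statPoints f' g) :
    ‖prox γ (x - γ • h) - v‖ ^ 2 + 2 * γ * (Freal f g (prox γ (x - γ • h)) - Freal f g v)
      ≤ ‖x - v‖ ^ 2 - 2 * γ * ⟪prox γ (x - γ • f' x) - v, h - f' x⟫_ℝ
        + 2 * γ ^ 2 * ‖h - f' x‖ ^ 2 := by
  have h1 := px_main hs hc hγ hγL x h hv.1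
  have h2 := px_nonexp hs hγ (x - γ • h) (x - γ • f' x)
  have h3 : ‖x - γ • h - (x - γ • f' x)‖ = γ * ‖h - f' x‖ := by
    rw [show x - γ • h - (x - γ • f' x) = - (γ • (h - f' x)) by module, norm_neg, norm_smul,
      Real.norm_of_nonneg hγ.le]
  rw [h3] at h2
  set p := prox γ (x - γ • h)
  set T := prox γ (x - γ • f' x)
  have h4 := abs_le.1 (abs_real_inner_le_norm (p - T) (h - f' x))
  have h5 : ⟪p - v, h - f' x⟫_ℝ = ⟪T - v, h - f' x⟫_ℝ + ⟪p - T, h - f' x⟫_ℝ := by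
    rw [← inner_add_left]; congr 1; abel
  have h6 := mul_le_mul_of_nonneg_right h2 (norm_nonneg (h - f' x))
  have h7 : -⟪p - T, h - f' x⟫_ℝ ≤ γ * ‖h - f' x‖ * ‖h - f' x‖ := by linarith [h4.1]
  have h8 := mul_le_mul_of_nonneg_left h7 hγ.le
  rw [h5] at h1
  nlinarith

lemma px_T_le (hs : ProxSetting f f' g L prox) (hc : ConvexOn ℝ Set.univ f)
    {γ : ℝ} (hγ : 0 < γ) (hγL : γ ≤ 1 / L) (x : E) {v : E} (hv : v ∈ statPoints f' g) :
    ‖prox γ (x - γ • f' x) - v‖ ≤ ‖x - v‖ := by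
  have h1 := px_main hs hc hγ hγL x (f' x) hv.1
  have h2 := px_min_of_stat hs hc hv _ (px_prox_dom hs hγ (x - γ • f' x))
  rw [sub_self, inner_zero_right] at h1
  have : ‖prox γ (x - γ • f' x) - v‖ ^ 2 ≤ ‖x - v‖ ^ 2 := by
    nlinarith [mul_nonneg hγ.le (sub_nonneg.2 h2)]
  exact (sq_le_sq₀ (norm_nonneg _) (norm_nonneg _)).1 this

end det

lemma px_RS {Ω : Type*} {m0 : MeasurableSpace Ω} {μ : Measure Ω} [IsProbabilityMeasure μ]
    (ℱ : Filtration ℕ m0) (U a : ℕ → Ω → ℝ)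
    (hU : StronglyAdapted ℱ U) (ha : StronglyAdapted ℱ a)
    (hUi : ∀ n, Integrable (U n) μ) (hai : ∀ n, Integrable (a n) μ)
    (hU0 : ∀ n ω, 0 ≤ U n ω) (ha0 : ∀ᵐ ω ∂μ, ∀ n, 0 ≤ a n ω)
    (hstep : ∀ n, μ[U (n + 1) | ℱ n] ≤ᵐ[μ] fun ω => U n ω + a n ω)
    (hsum : ∀ᵐ ω ∂μ, Summable fun n => a n ω) :
    ∀ᵐ ω ∂μ, ∃ l, Tendsto (fun n => U n ω) atTop (𝓝 l) := by
  have key : ∀ C : ℕ, ∀ᵐ ω ∂μ, (∀ n, ∑ k ∈ range n, a k ω ≤ C) →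
      ∃ l, Tendsto (fun n => U n ω) atTop (𝓝 l) := by
    intro C
    set A : ℕ → Set Ω := fun n => {ω | ∑ k ∈ range n, a k ω ≤ C} with hA
    have hAm : ∀ n, MeasurableSet[ℱ n] (A (n + 1)) := by
      intro n
      have : StronglyMeasurable[ℱ n] (fun ω => ∑ k ∈ range (n + 1), a k ω) := by
        refine Finset.stronglyMeasurable_fun_sum _ fun k hk => ?_
        exact (ha k).mono (ℱ.mono (by simp at hk; omega))
      exact this.measurable measurableSet_Iic
    have hA0 : A 0 = Set.univ := by
      ext ω; simp [hA]
    have hAm' : ∀ n, MeasurableSet[ℱ n] (A n) := by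
      intro n
      cases n with
      | zero => rw [hA0]; exact MeasurableSet.univ
      | succ n => exact ℱ.mono (Nat.le_succ n) _ (hAm n)
    set s : ℕ → Ω → ℝ := fun n ω => ∑ k ∈ range n, (A (k + 1)).indicator (a k) ω with hsdef
    have hs_meas : ∀ n, StronglyMeasurable[ℱ n] (s n) := by
      intro n
      refine Finset.stronglyMeasurable_fun_sum _ fun k hk => ?_
      exact ((ha k).indicator (hAm k)).mono (ℱ.mono (by simp at hk; omega))
    have hs_meas' : ∀ n, StronglyMeasurable[ℱ n] (s (n + 1)) := by
      intro n
      refine Finset.stronglyMeasurable_fun_sum _ fun k hk => ?_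
      exact ((ha k).indicator (hAm k)).mono (ℱ.mono (by simp at hk; omega))
    have hs_int : ∀ n, Integrable (s n) μ := by
      intro n
      refine integrable_finsetSum _ fun k _ => ?_
      exact (hai k).indicator (ℱ.le k _ (hAm k))
    set Z : ℕ → Ω → ℝ := fun n => (A n).indicator (U n) - s n with hZ
    have hZi : ∀ n, Integrable (Z n) μ := fun n =>
      ((hUi n).indicator (ℱ.le n _ (hAm' n))).sub (hs_int n)
    have hsle : ∀ᵐ ω ∂μ, ∀ n, s n ω ≤ C := by
      filter_upwards [ha0] with ω h0 n
      induction n with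
      | zero => simp [hsdef]
      | succ n ih =>
        by_cases hω : ω ∈ A (n + 1)
        · refine le_trans (Finset.sum_le_sum fun k _ => ?_) hω
          exact Set.indicator_le_self' (fun _ _ => h0 k) ω
        · simp only [hsdef] at ih ⊢
          rw [sum_range_succ, Set.indicator_of_notMem hω, add_zero]
          exact ih
    have hsup : Supermartingale Z ℱ μ := by
      refine supermartingale_nat (fun n => ((hU n).indicator (hAm' n)).sub (hs_meas n)) hZi ?_
      intro n
      have h1 : μ[Z (n + 1) | ℱ n] =ᵐ[μ] (A (n + 1)).indicator (μ[U (n + 1) | ℱ n]) - s (n + 1) := by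
        have e1 := condExp_sub ((hUi (n+1)).indicator (ℱ.le n _ (hAm n))) (hs_int (n + 1)) (ℱ n)
        have e2 := condExp_indicator (m := ℱ n) (hUi (n + 1)) (hAm n)
        have e3 := condExp_of_stronglyMeasurable (ℱ.le n) (hs_meas' n) (hs_int (n + 1))
        refine e1.trans ?_
        rw [e3]
        filter_upwards [e2] with ω hω
        simp [hω]
      filter_upwards [h1, hstep n, ha0] with ω e1 e2 h0
      rw [e1]
      simp only [hZ, hsdef, Pi.sub_apply, sum_range_succ]
      by_cases hω : ω ∈ A (n + 1)
      · have hω' : ω ∈ A n := by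
          simp only [hA, Set.mem_ofPred_eq, sum_range_succ] at hω ⊢
          linarith [h0 n]
        rw [Set.indicator_of_mem hω, Set.indicator_of_mem hω, Set.indicator_of_mem hω']
        linarith
      · rw [Set.indicator_of_notMem hω, Set.indicator_of_notMem hω]
        have : 0 ≤ (A n).indicator (U n) ω := Set.indicator_nonneg (fun _ _ => hU0 n _) ω
        linarith
    have hbdd : ∀ n, eLpNorm ((-Z) n) 1 μ ≤ ((∫ ω, Z 0 ω ∂μ) + 2 * C).toNNReal := by
      intro n
      have hlow : ∀ᵐ ω ∂μ, ‖(-Z) n ω‖ ≤ Z n ω + 2 * C := by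
        filter_upwards [hsle] with ω hω
        have : 0 ≤ (A n).indicator (U n) ω := Set.indicator_nonneg (fun _ _ => hU0 n _) ω
        have h2 := hω n
        have hC : (0:ℝ) ≤ C := Nat.cast_nonneg C
        simp only [hZ, Pi.neg_apply, norm_neg, Pi.sub_apply, Real.norm_eq_abs]
        rw [abs_le]; constructor <;> linarith
      rw [eLpNorm_one_eq_lintegral_enorm, ← ofReal_integral_norm_eq_lintegral_enorm
        (show Integrable ((-Z) n) μ from (hZi n).neg)]
      refine ENNReal.ofReal_le_ofReal ?_
      calc ∫ ω, ‖(-Z) n ω‖ ∂μ ≤ ∫ ω, (Z n ω + 2 * C) ∂μ :=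
            integral_mono_ae (hZi n).neg.norm ((hZi n).add (integrable_const _)) hlow
        _ = (∫ ω, Z n ω ∂μ) + 2 * C := by
            rw [integral_add (hZi n) (integrable_const _)]; simp
        _ ≤ _ := by
            have := hsup.setIntegral_le (Nat.zero_le n) (MeasurableSet.univ)
            simp only [setIntegral_univ] at this
            linarith
    have hconv := hsup.neg.exists_ae_tendsto_of_bdd hbdd
    filter_upwards [hconv, hsle, ha0] with ω ⟨l, hl⟩ hsl h0 hall
    have hmem : ∀ n, ω ∈ A n := hall
    have hmono : Monotone fun n => s n ω := by
      refine monotone_nat_of_le_succ fun n => ?_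
      simp only [hsdef, sum_range_succ]
      rw [Set.indicator_of_mem (hmem (n+1))]
      linarith [h0 n]
    have hst := tendsto_atTop_ciSup hmono ⟨C, by rintro _ ⟨n, rfl⟩; exact hsl n⟩
    refine ⟨-l + _, (hl.neg.add hst).congr fun n => ?_⟩
    simp [hZ, Set.indicator_of_mem (hmem n)]
  filter_upwards [ae_all_iff.2 key, ha0, hsum] with ω hk h0 hsm
  obtain ⟨C, hC⟩ := exists_nat_ge (∑' n, a n ω)
  exact hk C fun n => (hsm.sum_le_tsum _ (fun k _ => h0 k)).trans hC

section prob
variable {E : Type*} [NormedAddCommGroup E] [InnerProductSpace ℝ E] [FiniteDimensional ℝ E]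

lemma px_memLp {Ω : Type*} {m0 : MeasurableSpace Ω} {μ : Measure Ω} [IsProbabilityMeasure μ]
    {φ : E → E} {K : ℝ} (hK : 0 ≤ K) (hφ : ∀ x y, ‖φ x - φ y‖ ≤ K * ‖x - y‖)
    {X : Ω → E} (hX : MemLp X 2 μ) : MemLp (fun ω => φ (X ω)) 2 μ := by
  have h1 : LipschitzWith ⟨K, hK⟩ (fun x => φ x - φ 0) := by
    refine LipschitzWith.of_dist_le_mul fun x y => ?_
    rw [dist_eq_norm, dist_eq_norm, sub_sub_sub_cancel_right]
    exact hφ x y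
  have h2 := (h1.comp_memLp (by simp) hX).add (memLp_const (φ 0))
  convert h2 using 1
  ext ω; simp

lemma px_cont {φ : E → E} {K : ℝ} (hK : 0 ≤ K) (hφ : ∀ x y, ‖φ x - φ y‖ ≤ K * ‖x - y‖) :
    Continuous φ := by
  have h1 : LipschitzWith ⟨K, hK⟩ φ := by
    refine LipschitzWith.of_dist_le_mul fun x y => ?_
    rw [dist_eq_norm, dist_eq_norm]
    exact hφ x y
  exact h1.continuous

lemma px_prob
    (f : E → ℝ) (f' : E → E) (g : E → EReal) (L : ℝ) (prox : ℝ → E → E)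
    (hs : ProxSetting f f' g L prox)
    (hfconv : ConvexOn ℝ Set.univ f)
    {Ω : Type*} [m0 : MeasurableSpace Ω] (μ : Measure Ω) [IsProbabilityMeasure μ]
    [MeasurableSpace E] [BorelSpace E]
    (γ : ℕ → ℝ) (hγ : ∀ n : ℕ, 1 ≤ n → 0 < γ n ∧ γ n ≤ 1 / L)
    (θ H : ℕ → Ω → E)
    (hθ0 : ∃ c : E, (∀ ω, θ 0 ω = c) ∧ g c ≠ ⊤)
    (hrec : ∀ n : ℕ, ∀ ω, θ (n + 1) ω = prox (γ (n + 1)) (θ n ω - γ (n + 1) • H (n + 1) ω))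
    (hHmeas : ∀ n : ℕ, 1 ≤ n → Measurable (H n))
    (hH2 : ∀ n : ℕ, 1 ≤ n → MemLp (H n) 2 μ)
    (𝓕 : ℕ → MeasurableSpace Ω)
    (h𝓕 : ∀ n : ℕ, 𝓕 n = ⨆ i ∈ Finset.Icc 1 n, MeasurableSpace.comap (H i) inferInstance)
    (eps1 eps2 : ℕ → Ω → ℝ)
    (heps1 : ∀ n : ℕ, eps1 n = fun ω => ‖(μ[fun ω' => H (n + 1) ω' - f' (θ n ω')|𝓕 n]) ω‖)
    (heps2 : ∀ n : ℕ, eps2 n = μ[fun ω' => ‖H (n + 1) ω' - f' (θ n ω')‖ ^ 2|𝓕 n])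
    (hbd : ∀ᵐ ω ∂μ, ∃ C : ℝ, ∀ n, ‖θ n ω‖ ≤ C)
    (hcond : ∀ B : ℝ, 0 ≤ B → ∀ᵐ ω ∂μ,
      Summable fun n =>
        if ‖θ n ω‖ ≤ B then γ (n + 1) * (eps1 n ω + γ (n + 1) * eps2 n ω) else 0)
    (v : E) (hv : v ∈ statPoints f' g) :
    ∀ᵐ ω ∂μ, (∃ l : ℝ, Tendsto (fun n => ‖θ n ω - v‖) atTop (nhds l)) ∧
      Summable fun n => γ (n + 1) * (Freal f g (θ (n + 1) ω) - Freal f g v) := by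
  have hγp : ∀ n, 0 < γ (n + 1) := fun n => (hγ (n + 1) (by omega)).1
  have hγL : ∀ n, γ (n + 1) ≤ 1 / L := fun n => (hγ (n + 1) (by omega)).2
  have hHm : ∀ i n, 1 ≤ i → i ≤ n → Measurable[𝓕 n] (H i) := by
    intro i n h1 h2
    rw [h𝓕 n, measurable_iff_comap_le]
    exact le_iSup₂_of_le i (by simp [h1, h2]) le_rfl
  let ℱ : Filtration ℕ m0 := ⟨𝓕, by
    intro i j hij
    rw [h𝓕 i]
    refine iSup₂_le fun k hk => ?_
    rw [Finset.mem_Icc] at hk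
    exact measurable_iff_comap_le.1 (hHm k j hk.1 (hk.2.trans hij)), by
    intro i
    rw [h𝓕 i]
    refine iSup₂_le fun k hk => ?_
    rw [Finset.mem_Icc] at hk
    exact measurable_iff_comap_le.1 (hHmeas k hk.1)⟩
  have hprox1 : ∀ n x y, ‖prox (γ (n+1)) x - prox (γ (n+1)) y‖ ≤ 1 * ‖x - y‖ := by
    intro n x y; rw [one_mul]; exact px_nonexp hs (hγp n) x y
  have hproxc : ∀ n, Continuous (prox (γ (n+1))) := fun n => px_cont zero_le_one (hprox1 n)
  have hf'c : Continuous f' := px_cont hs.L_pos.le hs.lip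
  have hfc : Continuous f := continuous_iff_continuousAt.2 fun x => (hs.f_grad x).continuousAt
  have hFm : Measurable (Freal f g) := by
    unfold Freal
    exact hfc.measurable.add hs.g_lsc.measurable.ereal_toReal
  have hθm : ∀ n, Measurable[𝓕 n] (θ n) := by
    intro n
    induction n with
    | zero =>
      obtain ⟨c, hc, -⟩ := hθ0
      rw [show θ 0 = fun _ => c from funext hc]
      exact measurable_const
    | succ n ih =>
      rw [show θ (n + 1) = fun ω => _ from funext (hrec n)]
      refine (hproxc n).measurable.comp ?_
      exact (ih.mono (ℱ.mono (Nat.le_succ n)) le_rfl).sub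
        ((hHm (n+1) (n+1) (by omega) le_rfl).const_smul (γ (n+1)))
  have hθL : ∀ n, MemLp (θ n) 2 μ := by
    intro n
    induction n with
    | zero =>
      obtain ⟨c, hc, -⟩ := hθ0
      rw [show θ 0 = fun _ => c from funext hc]
      exact memLp_const c
    | succ n ih =>
      rw [show θ (n + 1) = fun ω => _ from funext (hrec n)]
      exact px_memLp zero_le_one (hprox1 n) (ih.sub ((hH2 (n+1) (by omega)).const_smul (γ (n+1))))
  have hf'L : ∀ n, MemLp (fun ω => f' (θ n ω)) 2 μ := fun n =>
    px_memLp hs.L_pos.le hs.lip (hθL n)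
  set η : ℕ → Ω → E := fun n ω => H (n + 1) ω - f' (θ n ω) with hη
  have hηL : ∀ n, MemLp (η n) 2 μ := fun n => (hH2 (n+1) (by omega)).sub (hf'L n)
  set T : ℕ → Ω → E := fun n ω => prox (γ (n+1)) (θ n ω - γ (n+1) • f' (θ n ω)) - v with hT
  have hTm : ∀ n, StronglyMeasurable[𝓕 n] (T n) := by
    intro n
    have : Measurable[𝓕 n] (T n) := by
      have hc : Continuous fun x => prox (γ (n+1)) (x - γ (n+1) • f' x) - v :=
        ((hproxc n).comp (continuous_id.sub (hf'c.const_smul _))).sub continuous_const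
      exact hc.measurable.comp (hθm n)
    exact this.stronglyMeasurable
  have hTL : ∀ n, MemLp (T n) 2 μ := fun n =>
    (px_memLp zero_le_one (hprox1 n) ((hθL n).sub ((hf'L n).const_smul (γ (n+1))))).sub
      (memLp_const v)
  have hTθ : ∀ n ω, ‖T n ω‖ ≤ ‖θ n ω - v‖ := fun n ω =>
    px_T_le hs hfconv (hγp n) (hγL n) (θ n ω) hv
  set D : ℕ → Ω → ℝ := fun n ω => 2 * γ (n + 1) * (Freal f g (θ (n + 1) ω) - Freal f g v) with hD
  have hD0 : ∀ n ω, 0 ≤ D n ω := by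
    intro n ω
    have h1 : g (θ (n+1) ω) ≠ ⊤ := by
      rw [hrec]; exact px_prox_dom hs (hγp n) _
    have := px_min_of_stat hs hfconv hv _ h1
    have := hγp n
    exact mul_nonneg (by positivity) (by linarith)
  set U : ℕ → Ω → ℝ := fun n ω => ‖θ n ω - v‖ ^ 2 + ∑ k ∈ range n, D k ω with hU
  have hU0 : ∀ n ω, 0 ≤ U n ω := fun n ω =>
    add_nonneg (sq_nonneg _) (Finset.sum_nonneg fun k _ => hD0 k ω)
  have hUm : ∀ n, StronglyMeasurable[𝓕 n] (U n) := by
    intro n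
    refine StronglyMeasurable.add ?_ (Finset.stronglyMeasurable_fun_sum _ fun k hk => ?_)
    · have h1 : Measurable[𝓕 n] fun ω => ‖θ n ω - v‖ ^ 2 :=
        (show Continuous fun x : E => ‖x - v‖ ^ 2 by fun_prop).measurable.comp (hθm n)
      exact h1.stronglyMeasurable
    · have hk' : k + 1 ≤ n := by simpa using hk
      have h1 : Measurable[𝓕 n] (D k) :=
        ((hFm.sub_const (Freal f g v)).const_mul (2 * γ (k + 1))).comp
          ((hθm (k+1)).mono (ℱ.mono hk') le_rfl)
      exact h1.stronglyMeasurable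
  set R : ℕ → Ω → ℝ := fun n ω => U n ω - 2 * γ (n+1) * ⟪T n ω, η n ω⟫_ℝ
    + 2 * γ (n+1) ^ 2 * ‖η n ω‖ ^ 2 with hR
  have hUR : ∀ n ω, U (n + 1) ω ≤ R n ω := by
    intro n ω
    have := px_stoch hs hfconv (hγp n) (hγL n) (θ n ω) (H (n+1) ω) hv
    rw [← hrec] at this
    simp only [hU, hR, hD, hT, hη, sum_range_succ]
    linarith
  have hTηi : ∀ n, Integrable (fun ω => ⟪T n ω, η n ω⟫_ℝ) μ := fun n =>
    ((hTL n).norm.integrable_mul (hηL n).norm).mono' ((hTL n).1.inner (hηL n).1)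
      (ae_of_all _ fun ω => norm_inner_le_norm _ _)
  have hη2i : ∀ n, Integrable (fun ω => ‖η n ω‖ ^ 2) μ := fun n => (hηL n).integrable_norm_pow (by norm_num)
  have hRi : ∀ n, Integrable (U n) μ → Integrable (R n) μ := fun n hn =>
    (hn.sub ((hTηi n).const_mul _)).add ((hη2i n).const_mul _)
  have hUi : ∀ n, Integrable (U n) μ := by
    intro n
    induction n with
    | zero =>
      simp only [hU, range_zero, sum_empty, add_zero]
      exact ((hθL 0).sub (memLp_const v)).integrable_norm_pow (by norm_num)
    | succ n ih =>
      refine (hRi n ih).mono' ((hUm (n+1)).mono (ℱ.le (n+1))).aestronglyMeasurable ?_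
      filter_upwards with ω
      rw [Real.norm_of_nonneg (hU0 _ _)]
      exact hUR n ω
  set a : ℕ → Ω → ℝ := fun n ω => 2 * γ (n+1) * (‖T n ω‖ * eps1 n ω)
    + 2 * γ (n+1) ^ 2 * eps2 n ω with ha
  have he1m : ∀ n, StronglyMeasurable[𝓕 n] (eps1 n) := by
    intro n; rw [heps1]; exact stronglyMeasurable_condExp.norm
  have he2m : ∀ n, StronglyMeasurable[𝓕 n] (eps2 n) := by
    intro n; rw [heps2]; exact stronglyMeasurable_condExp
  have he1L : ∀ n, MemLp (eps1 n) 2 μ := by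
    intro n; rw [heps1]; exact ((hηL n).condExp (by norm_num)).norm
  have he2i : ∀ n, Integrable (eps2 n) μ := by
    intro n; rw [heps2]; exact integrable_condExp
  have he2p : ∀ᵐ ω ∂μ, ∀ n, 0 ≤ eps2 n ω := by
    rw [ae_all_iff]; intro n; rw [heps2]
    exact condExp_nonneg (ae_of_all _ fun ω => sq_nonneg _)
  have he1p : ∀ n ω, 0 ≤ eps1 n ω := by
    intro n ω; rw [heps1]; exact norm_nonneg _
  have ham : ∀ n, StronglyMeasurable[𝓕 n] (a n) := fun n =>
    (((hTm n).norm.mul (he1m n)).const_mul _).add ((he2m n).const_mul _)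
  have hai : ∀ n, Integrable (a n) μ := fun n =>
    (((hTL n).norm.integrable_mul (he1L n)).const_mul _).add ((he2i n).const_mul _)
  have ha0 : ∀ᵐ ω ∂μ, ∀ n, 0 ≤ a n ω := by
    filter_upwards [he2p] with ω h n
    have := hγp n
    have := h n
    have := he1p n ω
    positivity
  have hstep : ∀ n, μ[U (n + 1) | ℱ n] ≤ᵐ[μ] fun ω => U n ω + a n ω := by
    intro n
    have h1 : μ[U (n + 1) | 𝓕 n] ≤ᵐ[μ] μ[R n | 𝓕 n] :=
      condExp_mono (hUi (n+1)) (hRi n (hUi n)) (ae_of_all _ (hUR n))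
    have h2 : μ[R n | 𝓕 n] =ᵐ[μ] μ[fun ω => U n ω - 2 * γ (n+1) * ⟪T n ω, η n ω⟫_ℝ | 𝓕 n]
        + μ[fun ω => 2 * γ (n+1) ^ 2 * ‖η n ω‖ ^ 2 | 𝓕 n] :=
      condExp_add ((hUi n).sub ((hTηi n).const_mul _)) ((hη2i n).const_mul _) _
    have h3 : μ[fun ω => U n ω - 2 * γ (n+1) * ⟪T n ω, η n ω⟫_ℝ | 𝓕 n] =ᵐ[μ]
        μ[U n | 𝓕 n] - μ[fun ω => 2 * γ (n+1) * ⟪T n ω, η n ω⟫_ℝ | 𝓕 n] :=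
      condExp_sub (hUi n) ((hTηi n).const_mul _) _
    have h4 : μ[U n | 𝓕 n] = U n := condExp_of_stronglyMeasurable (ℱ.le n) (hUm n) (hUi n)
    have h5 : μ[fun ω => 2 * γ (n+1) * ⟪T n ω, η n ω⟫_ℝ | 𝓕 n] =ᵐ[μ]
        (2 * γ (n+1)) • μ[fun ω => ⟪T n ω, η n ω⟫_ℝ | 𝓕 n] := condExp_smul (2 * γ (n+1)) _ _
    have h6 : μ[fun ω => 2 * γ (n+1) ^ 2 * ‖η n ω‖ ^ 2 | 𝓕 n] =ᵐ[μ]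
        (2 * γ (n+1) ^ 2) • μ[fun ω => ‖η n ω‖ ^ 2 | 𝓕 n] := condExp_smul (2 * γ (n+1) ^ 2) _ _
    have h7 : μ[fun ω => ⟪T n ω, η n ω⟫_ℝ | 𝓕 n] =ᵐ[μ] fun ω => ⟪T n ω, (μ[η n | 𝓕 n]) ω⟫_ℝ :=
      condExp_bilin_of_stronglyMeasurable_left (innerSL ℝ) (hTm n) (hTηi n)
        ((hηL n).integrable (by norm_num))
    filter_upwards [h1, h2, h3, h5, h6, h7] with ω k1 k2 k3 k5 k6 k7
    refine k1.trans ?_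
    rw [k2, Pi.add_apply, k3, Pi.sub_apply, h4, k5, k6, Pi.smul_apply, Pi.smul_apply, k7]
    have k8 := (abs_le.1 (abs_real_inner_le_norm (T n ω) ((μ[η n | 𝓕 n]) ω))).1
    have k9 : eps1 n ω = ‖(μ[η n | 𝓕 n]) ω‖ := by rw [heps1]
    have k10 : eps2 n ω = (μ[fun ω => ‖η n ω‖ ^ 2 | 𝓕 n]) ω := by rw [heps2]
    simp only [ha, smul_eq_mul]
    rw [k9, k10]
    have := mul_le_mul_of_nonneg_left k8 (show 0 ≤ 2 * γ (n+1) by linarith [hγp n])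
    linarith
  have hsum : ∀ᵐ ω ∂μ, Summable fun n => a n ω := by
    have hcond' : ∀ᵐ ω ∂μ, ∀ B : ℕ, Summable fun n =>
        if ‖θ n ω‖ ≤ (B:ℝ) then γ (n + 1) * (eps1 n ω + γ (n + 1) * eps2 n ω) else 0 :=
      ae_all_iff.2 fun B => hcond B (Nat.cast_nonneg B)
    filter_upwards [hcond', hbd, ha0, he2p] with ω hc ⟨C, hC⟩ h0 h2
    obtain ⟨B, hB⟩ := exists_nat_ge C
    have hθB : ∀ n, ‖θ n ω‖ ≤ B := fun n => (hC n).trans hB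
    have hsm := hc B
    simp only [hθB, if_true] at hsm
    refine Summable.of_nonneg_of_le h0 (fun n => ?_) (hsm.mul_left (2 * (B + ‖v‖ + 1)))
    have t1 : ‖T n ω‖ ≤ B + ‖v‖ + 1 := by
      have := hTθ n ω
      have := norm_sub_le (θ n ω) v
      linarith [hθB n]
    have t2 := mul_le_mul_of_nonneg_right t1 (mul_nonneg (hγp n).le (he1p n ω))
    have t3 : (1:ℝ) ≤ B + ‖v‖ + 1 := by
      have : (0:ℝ) ≤ B := Nat.cast_nonneg B
      linarith [norm_nonneg v]
    have t4 := mul_le_mul_of_nonneg_right t3 (mul_nonneg (sq_nonneg (γ (n+1))) (h2 n))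
    simp only [ha]
    linarith
  have hfin := px_RS ℱ U a hUm ham hUi hai hU0 ha0 hstep hsum
  filter_upwards [hfin] with ω ⟨l, hl⟩
  obtain ⟨M, hM⟩ := hl.bddAbove_range
  have hDs : Summable fun n => D n ω := by
    refine summable_of_sum_range_le (c := M) (fun n => hD0 n ω) fun n => ?_
    have := hM ⟨n, rfl⟩
    simp only [hU] at this
    linarith [sq_nonneg ‖θ n ω - v‖]
  constructor
  · have h1 := hl.sub hDs.hasSum.tendsto_sum_nat
    refine ⟨_, ((Real.continuous_sqrt.tendsto _).comp h1).congr fun n => ?_⟩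
    simp only [hU, Function.comp, add_sub_cancel_right]
    exact Real.sqrt_sq (norm_nonneg _)
  · refine (hDs.mul_left (1/2)).congr fun n => ?_
    simp only [hD]; ring

lemma px_deg {f : E → ℝ} {f' : E → E} {g : E → EReal} {L : ℝ} {prox : ℝ → E → E}
    (hs : ProxSetting f f' g L prox) (hc : ConvexOn ℝ Set.univ f)
    {γ : ℕ → ℝ} (hγ : ∀ n, 0 < γ (n + 1)) (x : ℕ → E) (hx : ∀ n, g (x (n + 1)) ≠ ⊤)
    {m : E} (hm : m ∈ statPoints f' g)
    (hsum : Summable fun n => γ (n + 1) * (Freal f g (x (n + 1)) - Freal f g m))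
    (hdiv : Tendsto (fun N => ∑ k ∈ Finset.range N, γ k) atTop atTop)
    (hbd : ∃ C : ℝ, ∀ n, ‖x n‖ ≤ C)
    (hlim : ∀ v ∈ statPoints f' g, ∃ l : ℝ, Tendsto (fun n => ‖x n - v‖) atTop (nhds l)) :
    ∃ v ∈ statPoints f' g, Tendsto x atTop (nhds v) := by
  have hnn : ∀ n, 0 ≤ Freal f g (x (n + 1)) - Freal f g m := fun n =>
    sub_nonneg.2 (px_min_of_stat hs hc hm _ (hx n))
  have hfreq : ∀ k : ℕ, ∃ᶠ n in atTop,
      Freal f g (x (n + 1)) - Freal f g m < 1 / ((k : ℝ) + 1) := by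
    intro k hcon
    have hcon' : ∀ᶠ n in atTop, 1 / ((k : ℝ) + 1) ≤ Freal f g (x (n + 1)) - Freal f g m := by
      filter_upwards [hcon] with n hn using not_lt.1 hn
    have hg : Summable fun n => γ (n + 1) := by
      refine Summable.of_norm_bounded_eventually_nat (hsum.mul_left ((k : ℝ) + 1)) ?_
      filter_upwards [hcon'] with n hn
      rw [Real.norm_of_nonneg (hγ n).le]
      rw [div_le_iff₀ (by positivity)] at hn
      have := mul_le_mul_of_nonneg_left hn (hγ n).le
      linarith
    have hg' : Summable γ := (summable_nat_add_iff 1).1 hg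
    exact not_tendsto_nhds_of_tendsto_atTop hdiv _ hg'.hasSum.tendsto_sum_nat
  obtain ⟨φ, hφ, hφ2⟩ := extraction_forall_of_frequently hfreq
  obtain ⟨C, hC⟩ := hbd
  obtain ⟨z, -, ψ, hψ, hz⟩ := tendsto_subseq_of_bounded
    (Metric.isBounded_closedBall (x := (0:E)) (r := C))
    (x := fun k => x (φ k + 1)) (fun k => by simpa using hC _)
  have hfc : Continuous f := continuous_iff_continuousAt.2 fun x => (hs.f_grad x).continuousAt
  have hF : Tendsto (fun k => Freal f g (x (φ (ψ k) + 1)) - Freal f g m) atTop (𝓝 0) :=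
    squeeze_zero (fun k => hnn _) (fun k => (hφ2 (ψ k)).le)
      (tendsto_one_div_add_atTop_nhds_zero_nat.comp hψ.tendsto_atTop)
  have hG : Tendsto (fun k => (g (x (φ (ψ k) + 1))).toReal) atTop (𝓝 (Freal f g m - f z)) := by
    have h1 := (hF.add_const (Freal f g m)).sub ((hfc.tendsto z).comp hz)
    rw [zero_add] at h1
    refine h1.congr fun k => ?_
    simp [Freal, Function.comp]
  have hgz : g z ≤ ((Freal f g m - f z : ℝ) : EReal) := by
    refine EReal.le_of_forall_lt_iff_le.1 fun r hr => ?_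
    by_contra hcon
    push Not at hcon
    have h1 := hz.eventually (hs.g_lsc z r hcon)
    have h2 : ∀ᶠ k in atTop, r ≤ (g (x (φ (ψ k) + 1))).toReal := by
      filter_upwards [h1] with k hk
      have hk' : (r : EReal) < g (x (φ (ψ k) + 1)) := hk
      rw [← px_coe hs (hx _)] at hk'
      exact (EReal.coe_lt_coe_iff.1 hk').le
    have h3 := ge_of_tendsto hG h2
    have h4 := EReal.coe_lt_coe_iff.1 hr
    linarith
  have hzt : g z ≠ ⊤ := ne_top_of_le_ne_top (EReal.coe_ne_top _) hgz
  have hzs : z ∈ statPoints f' g := by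
    refine px_stat_of_min hs hzt fun w hw => ?_
    refine le_trans ?_ (px_min_of_stat hs hc hm w hw)
    rw [← px_coe hs hzt, EReal.coe_le_coe_iff] at hgz
    simp only [Freal] at hgz ⊢
    linarith
  refine ⟨z, hzs, ?_⟩
  obtain ⟨l, hl⟩ := hlim z hzs
  have hsub : Tendsto (fun k => φ (ψ k) + 1) atTop atTop :=
    (tendsto_add_atTop_nat 1).comp (hφ.tendsto_atTop.comp hψ.tendsto_atTop)
  have h1 := hl.comp hsub
  have h2 : Tendsto (fun k => ‖x (φ (ψ k) + 1) - z‖) atTop (𝓝 0) :=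
    tendsto_iff_norm_sub_tendsto_zero.1 hz
  have h3 : l = 0 := tendsto_nhds_unique h1 h2
  rw [h3] at hl
  exact tendsto_iff_norm_sub_tendsto_zero.2 hl

lemma px_dense (S D : Set E) (hD : S ⊆ closure D) (x : ℕ → E)
    (h : ∀ v ∈ D, ∃ l : ℝ, Tendsto (fun n => ‖x n - v‖) atTop (nhds l)) :
    ∀ v ∈ S, ∃ l : ℝ, Tendsto (fun n => ‖x n - v‖) atTop (nhds l) := by
  intro v hv
  apply cauchySeq_tendsto_of_complete
  rw [Metric.cauchySeq_iff']
  intro ε hε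
  obtain ⟨w, hw, hwv⟩ := Metric.mem_closure_iff.1 (hD hv) (ε / 4) (by positivity)
  obtain ⟨l, hl⟩ := h w hw
  obtain ⟨N, hN⟩ := Metric.cauchySeq_iff'.1 hl.cauchySeq (ε / 4) (by positivity)
  refine ⟨N, fun n hn => ?_⟩
  have h1 := hN n hn
  rw [Real.dist_eq, abs_lt] at h1 ⊢
  rw [dist_eq_norm] at hwv
  have key : ∀ k, |‖x k - v‖ - ‖x k - w‖| ≤ ‖v - w‖ := by
    intro k
    have := abs_norm_sub_norm_le (x k - v) (x k - w)
    rwa [sub_sub_sub_cancel_left, norm_sub_rev w v] at this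
  have k1 := abs_le.1 (key n)
  have k2 := abs_le.1 (key N)
  constructor <;> linarith [h1.1, h1.2, k1.1, k1.2, k2.1, k2.2]

end prob

/-- **Corollary 3.3** (a.s. convergence of the stochastic perturbed proximal gradient). -/
theorem stmt5
    {E : Type*} [NormedAddCommGroup E] [InnerProductSpace ℝ E] [FiniteDimensional ℝ E]
    (f : E → ℝ) (f' : E → E) (g : E → EReal) (L : ℝ) (prox : ℝ → E → E)
    (hs : ProxSetting f f' g L prox)
    (hfconv : ConvexOn ℝ Set.univ f)
    (hargmin : ∃ m : E, ∀ v : E, Fval f g m ≤ Fval f g v)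
    {Ω : Type*} [MeasurableSpace Ω] (μ : Measure Ω) [IsProbabilityMeasure μ]
    [MeasurableSpace E] [BorelSpace E]
    (γ : ℕ → ℝ) (hγ : ∀ n : ℕ, 1 ≤ n → 0 < γ n ∧ γ n ≤ 1 / L)
    (θ H : ℕ → Ω → E)
    (hθ0 : ∃ c : E, (∀ ω, θ 0 ω = c) ∧ g c ≠ ⊤)
    (hrec : ∀ n : ℕ, ∀ ω, θ (n + 1) ω = prox (γ (n + 1)) (θ n ω - γ (n + 1) • H (n + 1) ω))
    (hHmeas : ∀ n : ℕ, 1 ≤ n → Measurable (H n))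
    (hH2 : ∀ n : ℕ, 1 ≤ n → MemLp (H n) 2 μ)
    (𝓕 : ℕ → MeasurableSpace Ω)
    (h𝓕 : ∀ n : ℕ, 𝓕 n = ⨆ i ∈ Finset.Icc 1 n, MeasurableSpace.comap (H i) inferInstance)
    (eps1 eps2 : ℕ → Ω → ℝ)
    (heps1 : ∀ n : ℕ, eps1 n = fun ω => ‖(μ[fun ω' => H (n + 1) ω' - f' (θ n ω')|𝓕 n]) ω‖)
    (heps2 : ∀ n : ℕ, eps2 n = μ[fun ω' => ‖H (n + 1) ω' - f' (θ n ω')‖ ^ 2|𝓕 n])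
    (hbd : ∀ᵐ ω ∂μ, ∃ C : ℝ, ∀ n, ‖θ n ω‖ ≤ C)
    (hcond : ∀ B : ℝ, 0 ≤ B → ∀ᵐ ω ∂μ,
      Summable fun n =>
        if ‖θ n ω‖ ≤ B then γ (n + 1) * (eps1 n ω + γ (n + 1) * eps2 n ω) else 0) :
    (∀ᵐ ω ∂μ, ∀ θs ∈ statPoints f' g,
        ∃ l : ℝ, Tendsto (fun n => ‖θ n ω - θs‖) atTop (nhds l)) ∧
      (Tendsto (fun N => ∑ k ∈ Finset.range N, γ k) atTop atTop →
        ∀ᵐ ω ∂μ, ∃ θs ∈ statPoints f' g, Tendsto (fun n => θ n ω) atTop (nhds θs)) := by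

  have hp := px_prob f f' g L prox hs hfconv μ γ hγ θ H hθ0 hrec hHmeas hH2 𝓕 h𝓕 eps1 eps2
    heps1 heps2 hbd hcond
  have hγp : ∀ n, 0 < γ (n + 1) := fun n => (hγ (n + 1) (by omega)).1
  have h1 : ∀ᵐ ω ∂μ, ∀ θs ∈ statPoints f' g,
        ∃ l : ℝ, Tendsto (fun n => ‖θ n ω - θs‖) atTop (nhds l) := by
    obtain ⟨D, hDS, hDc, hDd⟩ :=
      (TopologicalSpace.IsSeparable.of_separableSpace (statPoints f' g)).exists_countable_dense_subset
    have : ∀ᵐ ω ∂μ, ∀ v ∈ D, ∃ l : ℝ, Tendsto (fun n => ‖θ n ω - v‖) atTop (nhds l) := by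
      rw [ae_ball_iff hDc]
      intro v hv
      filter_upwards [hp v (hDS hv)] with ω hω using hω.1
    filter_upwards [this] with ω hω
    exact px_dense _ D hDd _ hω
  refine ⟨h1, fun hdiv => ?_⟩
  obtain ⟨m, hm⟩ := px_exists_stat hs hargmin
  filter_upwards [h1, hp m hm, hbd] with ω k1 k2 k3
  refine px_deg hs hfconv hγp (fun n => θ n ω) (fun n => ?_) hm k2.2 hdiv k3 k1
  simp only [hrec]
  exact px_prox_dom hs (hγp n) _
end
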